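/- Let G be a connected linear algebraic group over a field k, and let n be the stable exponent of Pic(G). Then for every field extension K/k, the abelian group Pic(G_K) is killed by n. -/

import Mathlib

open TensorProduct

universe u

/-- An `R`-module is invertible (a line bundle on `Spec R`). -/
def IsInvertibleModule (R : Type u) [CommRing R] (M : Type u) [AddCommGroup M]
    [Module R M] : Prop :=
  ∃ (N : Type u) (_ : AddCommGroup N) (_ : Module R N), Nonempty ((M ⊗[R] N) ≃ₗ[R] R)

/-- `Pic(G_K)` is killed by `m`: every invertible module over `K ⊗[k] A` (the coordinate
ring of `G_K = Spec (K ⊗ A)`) has trivial `m`-th tensor power. -/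
def PicKilledBy (k : Type u) [Field k] (A : Type u) [CommRing A] [Algebra k A]
    (K : Type u) [Field K] [Algebra k K] (m : ℕ) : Prop :=
  ∀ (P : Type u) [AddCommGroup P] [Module (K ⊗[k] A) P],
    IsInvertibleModule (K ⊗[k] A) P →
    Nonempty ((⨂[K ⊗[k] A]^m P) ≃ₗ[K ⊗[k] A] (K ⊗[k] A))

open Module in
/-- In an invertible module any two elements are proportional. -/
lemma Module.Invertible.dual_smul_comm {R M : Type*} [CommRing R] [AddCommGroup M] [Module R M]
    [Module.Invertible R M] (f : Dual R M) (x y : M) : f x • y = f y • x := by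
  simpa using congr(TensorProduct.lid R M (f.rTensor M $(tmul_comm (m₁ := x) (m₂ := y))))

open Module in
/-- An invertible module is locally generated by one element. -/
lemma Module.Invertible.exists_dual_apply_notMem {R M : Type*} [CommRing R] [AddCommGroup M]
    [Module R M] [Module.Invertible R M] {I : Ideal R} (hI : I ≠ ⊤) :
    ∃ (f : Dual R M) (x : M), f x ∉ I := by
  by_contra! h
  have key (t : Dual R M ⊗[R] M) : Module.Invertible.linearEquiv R M t ∈ I := by
    induction t with
    | zero => simp
    | tmul f x => exact h f x
    | add s t hs ht => rw [map_add]; exact I.add_mem hs ht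
  obtain ⟨t, ht⟩ := (Module.Invertible.linearEquiv R M).surjective 1
  exact hI ((Ideal.eq_top_iff_one I).mpr (ht ▸ key t))

lemma TensorPower.exists_invertible_and_mk_eq_pow (R : Type u) [CommRing R] (M : Type u)
    [AddCommGroup M] [Module R M] [Module.Invertible R M] (n : ℕ) :
    ∃ _ : Module.Invertible R (⨂[R]^n M),
      CommRing.Pic.mk R (⨂[R]^n M) = CommRing.Pic.mk R M ^ n := by
  induction n with
  | zero =>
    let e : R ≃ₗ[R] ⨂[R]^0 M := (PiTensorProduct.isEmptyEquiv (Fin 0)).symm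
    have h := Module.Invertible.congr e
    exact ⟨h, by rw [pow_zero, CommRing.Pic.mk_eq_one_iff]; exact ⟨e.symm⟩⟩
  | succ n ih =>
    obtain ⟨h, hn⟩ := ih
    let e : (⨂[R]^n M) ⊗[R] M ≃ₗ[R] ⨂[R]^(n + 1) M :=
      TensorProduct.congr (.refl R _)
          (PiTensorProduct.subsingletonEquiv (s := fun _ ↦ M) (0 : Fin 1)).symm ≪≫ₗ
        TensorPower.mulEquiv
    have h' := Module.Invertible.congr e
    exact ⟨h', by
      rw [pow_succ, ← hn, ← CommRing.Pic.mk_tensor, CommRing.Pic.mk_eq_mk_iff]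
      exact ⟨e.symm⟩⟩

/-- If a finite direct sum of copies of an invertible module is free, then the corresponding
tensor power is trivial: the isomorphism is the determinant. -/
lemma Module.Invertible.nonempty_tensorPower_equiv {R : Type u} [CommRing R] {M : Type u}
    [AddCommGroup M] [Module R M] [Module.Invertible R M] {n : ℕ}
    (φ : (Fin n → M) ≃ₗ[R] (Fin n → R)) : Nonempty ((⨂[R]^n M) ≃ₗ[R] R) := by
  obtain ⟨_, -⟩ := TensorPower.exists_invertible_and_mk_eq_pow R M n
  let D : MultilinearMap R (fun _ : Fin n ↦ M) R :=
    (Matrix.detRowAlternating (R := R) (n := Fin n)).toMultilinearMap.compLinearMap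
      fun i ↦ φ.toLinearMap ∘ₗ LinearMap.single R (fun _ ↦ M) i
  let δ : (⨂[R]^n M) →ₗ[R] R := PiTensorProduct.lift D
  have hδ (x : Fin n → M) : Matrix.det (fun i ↦ φ (Pi.single i (x i))) ∈ LinearMap.range δ :=
    ⟨PiTensorProduct.tprod R x, by simp [δ, D]; rfl⟩
  refine ⟨.ofBijective δ (bijective_of_surjective (LinearMap.range_eq_top.mp ?_))⟩
  by_contra hne
  obtain ⟨𝔪, h𝔪, hle⟩ := Ideal.exists_le_maximal (LinearMap.range δ) hne
  obtain ⟨f, l, hfl⟩ := exists_dual_apply_notMem (M := M) h𝔪.ne_top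
  let x (j : Fin n) : Fin n → M := φ.symm (Pi.single j 1)
  let Λ : Matrix (Fin n) (Fin n) R := fun j i ↦ f (x j i)
  let Φ : Matrix (Fin n) (Fin n) R := fun i ↦ φ (Pi.single i l)
  have hmul : Λ * Φ = f l • (1 : Matrix (Fin n) (Fin n) R) := by
    have key (j : Fin n) : ∑ i, Λ j i • φ (Pi.single i l) = f l • Pi.single j (1 : R) := by
      have : φ (x j) = Pi.single j 1 := φ.apply_symm_apply _
      rw [← this, ← map_smul]
      simp_rw [← map_smul, ← map_sum]
      congr 1
      ext i
      simp [Finset.sum_apply, Pi.single_apply, Λ, dual_smul_comm f (x j i) l]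
    ext j i
    have := congr_fun (key j) i
    rw [Matrix.mul_apply]
    simpa [Φ, Finset.sum_apply, Matrix.one_apply, Pi.single_apply, eq_comm] using this
  have hdet : Λ.det * Φ.det = f l ^ n := by rw [← Matrix.det_mul, hmul]; simp
  exact hfl (h𝔪.isPrime.mem_of_pow_mem n
    (hdet ▸ 𝔪.mul_mem_left _ (hle (hδ fun _ ↦ l))))

/-- The norm argument: the kernel of `Pic R → Pic S` is killed by the rank of `S` if `S` is free
of finite rank over `R`. -/
lemma CommRing.Pic.pow_eq_one_of_mapAlgebra_eq_one {R S : Type u} [CommRing R] [CommRing S]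
    [Algebra R S] {n : ℕ} (b : Module.Basis (Fin n) R S) {x : CommRing.Pic R}
    (hx : mapAlgebra R S x = 1) : x ^ n = 1 := by
  rw [mapAlgebra_apply, mk_eq_one_iff] at hx
  obtain ⟨e⟩ := hx
  let φ : (Fin n → x.AsModule) ≃ₗ[R] (Fin n → R) :=
    (TensorProduct.piScalarRight R R x.AsModule (Fin n)).symm ≪≫ₗ
      TensorProduct.comm R _ _ ≪≫ₗ
      TensorProduct.congr b.equivFun.symm (.refl R _) ≪≫ₗ e.restrictScalars R ≪≫ₗ b.equivFun
  obtain ⟨_, h⟩ := TensorPower.exists_invertible_and_mk_eq_pow R x.AsModule n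
  rw [mk_eq_self] at h
  rw [← h, mk_eq_one_iff]
  exact Module.Invertible.nonempty_tensorPower_equiv φ

lemma picKilledBy_iff_pow_eq_one (k : Type u) [Field k] (A : Type u) [CommRing A] [Algebra k A]
    (K : Type u) [Field K] [Algebra k K] (m : ℕ) :
    PicKilledBy k A K m ↔ ∀ x : CommRing.Pic (K ⊗[k] A), x ^ m = 1 := by
  refine ⟨fun h x ↦ ?_, fun h P _ _ ⟨N, _, _, ⟨e⟩⟩ ↦ ?_⟩
  · obtain ⟨_, hm⟩ := TensorPower.exists_invertible_and_mk_eq_pow (K ⊗[k] A) x.AsModule m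
    rw [CommRing.Pic.mk_eq_self] at hm
    rw [← hm, CommRing.Pic.mk_eq_one_iff]
    exact h x.AsModule ⟨_, _, _,
      ⟨TensorProduct.comm _ _ _ ≪≫ₗ Module.Invertible.linearEquiv (K ⊗[k] A) x.AsModule⟩⟩
  · have := Module.Invertible.left e
    obtain ⟨_, hm⟩ := TensorPower.exists_invertible_and_mk_eq_pow (K ⊗[k] A) P m
    rw [← CommRing.Pic.mk_eq_one_iff, hm, h]

/-- If `Pic(G_{K'})` is killed by `m` for a finite extension `K'/K`, then `Pic(G_K)` is killed
by `[K' : K] * m`. -/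
lemma PicKilledBy.pow_pow_finrank_eq_one {k : Type u} [Field k] {A : Type u} [CommRing A]
    [Algebra k A] {K K' : Type u} [Field K] [Field K'] [Algebra k K] [Algebra k K']
    [Algebra K K'] [IsScalarTower k K K'] [FiniteDimensional K K'] {m : ℕ}
    (h : PicKilledBy k A K' m) (x : CommRing.Pic (K ⊗[k] A)) :
    (x ^ m) ^ Module.finrank K K' = 1 := by
  rw [picKilledBy_iff_pow_eq_one] at h
  let e : (K ⊗[k] A) ⊗[K] K' ≃+* K' ⊗[k] A :=
    (Algebra.TensorProduct.comm K (K ⊗[k] A) K').toRingEquiv.trans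
      (Algebra.TensorProduct.cancelBaseChange k K K' K' A).toRingEquiv
  refine CommRing.Pic.pow_eq_one_of_mapAlgebra_eq_one
    (Algebra.TensorProduct.basis (K ⊗[k] A) (Module.finBasis K K')) ?_
  have hid : e.symm.toRingHom.comp e.toRingHom = .id _ := RingHom.ext e.symm_apply_apply
  rw [map_pow, ← CommRing.Pic.mapRingHom_id_apply (M := CommRing.Pic.mapAlgebra _ _ x), ← hid,
    ← CommRing.Pic.mapRingHom_mapRingHom, ← map_pow, h, map_one]

/-- A common divisor of the degrees of the residue fields of a finite-dimensional algebra divides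
its dimension. -/
lemma dvd_finrank_of_forall_dvd_finrank_quotient {K B : Type u} [Field K] [CommRing B]
    [Algebra K B] [FiniteDimensional K B] {c : ℕ}
    (h : ∀ p : Ideal B, p.IsPrime → c ∣ Module.finrank K (B ⧸ p)) : c ∣ Module.finrank K B := by
  have : IsNoetherianRing B := .of_finite K B
  suffices H : ∀ (N : Type u) [AddCommGroup N] [Module B N] [Module.Finite B N] [Module K N]
      [IsScalarTower K B N], c ∣ Module.finrank K N from H B
  intro N _ _ hN
  induction hN using IsNoetherianRing.induction_on_isQuotientEquivQuotientPrime with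
  | subsingleton N =>
    intro _ _
    simp [Module.finrank_zero_of_subsingleton]
  | quotient N p f =>
    intro _ _
    rw [(f.restrictScalars K).finrank_eq]
    exact h p.1 p.2
  | exact N₁ N₂ N₃ f g hf hg hfg h₁ h₃ =>
    intro _ _
    let := Module.compHom N₁ (algebraMap K B)
    let := Module.compHom N₃ (algebraMap K B)
    have : IsScalarTower K B N₁ := .of_algebraMap_smul fun _ _ ↦ rfl
    have : IsScalarTower K B N₃ := .of_algebraMap_smul fun _ _ ↦ rfl
    have : Module.Finite K N₂ := .trans B N₂
    have hrank := (g.restrictScalars K).finrank_range_add_finrank_ker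
    rw [show (g.restrictScalars K).range = ⊤ from LinearMap.range_eq_top.mpr hg, finrank_top,
      show (g.restrictScalars K).ker = (f.restrictScalars K).range from
        SetLike.ext fun y ↦ hfg y,
      LinearMap.finrank_range_of_inj (f := f.restrictScalars K) hf] at hrank
    exact hrank ▸ dvd_add h₃ h₁

/-- Let `G = Spec A` be a connected linear algebraic group over a field
`k` (an integral, finitely generated, smooth Hopf algebra `A`), and let `n = d·m` be the
stable exponent of `Pic(G)`: `m` is the (uniform) exponent of `Pic(G_{K})` over the
splitting fields, and `d` is the gcd of the degrees of the splitting fields `k'/k`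
(a field `k'` splits `G` when the exponent `m` works over every extension of `k'`, which
by Lemma 2.2 is the characterization of splitting fields used in the proof).  Then for
every field extension `K / k`, the abelian group `Pic(G_K)` is killed by `n = d·m`. -/
theorem pic_killed_by_stable_exponent
    (k : Type u) [Field k] (A : Type u) [CommRing A] [HopfAlgebra k A]
    [IsDomain A] (hfg : Algebra.FiniteType k A) (hsm : Algebra.FormallySmooth k A)
    (m : ℕ) (hm : 0 < m)
    -- the set `D` of degrees of splitting fields of `G`
    (D : Set ℕ) (hne : D.Nonempty)
    (hsplit : ∀ e ∈ D, ∃ (k' : Type u) (_ : Field k') (_ : Algebra k k')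
      (_ : FiniteDimensional k k'), Module.finrank k k' = e ∧
        ∀ (K : Type u) [Field K] [Algebra k K] [Algebra k' K],
          IsScalarTower k k' K → PicKilledBy k A K m)
    -- `d` is the greatest common divisor of the degrees of splitting fields
    (d : ℕ) (hdvd : ∀ e ∈ D, d ∣ e) (hgcd : ∀ c : ℕ, (∀ e ∈ D, c ∣ e) → c ∣ d)
    -- conclusion: `Pic(G_K)` is killed by `n = d·m` for every field extension `K/k`
    (K : Type u) [Field K] [Algebra k K] :
    PicKilledBy k A K (d * m) := by
  rw [picKilledBy_iff_pow_eq_one]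
  intro x
  suffices H : orderOf (x ^ m) ∣ d by
    rw [mul_comm, pow_mul]
    exact orderOf_dvd_iff_pow_eq_one.mp H
  refine hgcd _ fun e he ↦ ?_
  obtain ⟨k', _, _, _, rfl, hk'⟩ := hsplit e he
  rw [← Module.finrank_baseChange (R := K) (S := k) (M' := k')]
  refine dvd_finrank_of_forall_dvd_finrank_quotient fun p hp ↦ ?_
  have : IsArtinianRing (K ⊗[k] k') := .of_finite K _
  let : Field ((K ⊗[k] k') ⧸ p) :=
    have := IsArtinianRing.isMaximal_of_isPrime p
    Ideal.Quotient.field p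
  let ι : k' →ₐ[k] (K ⊗[k] k') ⧸ p :=
    (Ideal.Quotient.mkₐ k p).comp Algebra.TensorProduct.includeRight
  let : Algebra k' ((K ⊗[k] k') ⧸ p) := ι.toAlgebra
  have h := hk' ((K ⊗[k] k') ⧸ p) (.of_algHom ι)
  exact orderOf_dvd_of_pow_eq_one (h.pow_pow_finrank_eq_one x)
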